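/- There exists an absolute constant A₀ > 0 with the following property. Let N be a positive integer, let (z_{ij})_{0 ≤ i,j < N} be complex numbers not all zero, and let f : ℝ² → ℂ vanish outside [0,N] × [0,N] and equal z_{ij} on each unit cell (i,j) + [0,1)². Then for every A ≥ A₀, (1/2) Σ_{i,j=0}^{N−1} |z_{ij}|² < ∫_{|ξ| < A} |f̂(ξ)|² dξ, where f̂(ξ) = ∫_{ℝ²} f(x) e^{−2πi ξ·x} dx. -/

import Mathlib

open MeasureTheory Real
open scoped FourierTransform

/-- The character `e^{-2πix}`. -/
noncomputable def EE (x : ℝ) : ℂ := Complex.exp (((-2 * π * x : ℝ) : ℂ) * Complex.I)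

/-- The Fourier transform of the unit interval. -/
noncomputable def GG (t : ℝ) : ℂ := ∫ x in (0:ℝ)..1, EE (x * t)

lemma EE_add (x y : ℝ) : EE (x + y) = EE x * EE y := by
  unfold EE
  rw [← Complex.exp_add]
  congr 1
  push_cast
  ring

lemma EE_cont : Continuous EE := by
  unfold EE
  fun_prop

lemma EE_int (n : ℤ) : EE n = 1 := by
  unfold EE
  rw [Complex.exp_eq_one_iff]
  refine ⟨-n, ?_⟩
  push_cast
  ring

lemma EE_norm (x : ℝ) : ‖EE x‖ = 1 := by
  unfold EE
  exact Complex.norm_exp_ofReal_mul_I _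

lemma EE_conj (x : ℝ) : (starRingEnd ℂ) (EE x) = EE (-x) := by
  unfold EE
  rw [← Complex.exp_conj]
  congr 1
  rw [map_mul, Complex.conj_I, Complex.conj_ofReal]
  push_cast
  ring

lemma GG_cont : Continuous GG := by
  unfold GG
  apply intervalIntegral.continuous_parametric_intervalIntegral_of_continuous'
  exact EE_cont.comp (by fun_prop)

lemma integral_EE (a b t : ℝ) (ht : t ≠ 0) :
    ∫ x in a..b, EE (x * t) = (EE (b * t) - EE (a * t)) / (((-2 * π * t : ℝ) : ℂ) * Complex.I) := by
  have hc : (((-2 * π * t : ℝ) : ℂ) * Complex.I) ≠ 0 := by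
    simp [ht, Real.pi_ne_zero]
  have := integral_exp_mul_complex (a := a) (b := b) hc
  have h2 : ∀ x : ℝ, EE (x * t) = Complex.exp ((((-2 * π * t : ℝ) : ℂ) * Complex.I) * x) := by
    intro x
    unfold EE
    congr 1
    push_cast
    ring
  simp_rw [h2]
  exact this

lemma GG_normsq (t : ℝ) (ht : t ≠ 0) : ‖GG t‖ ^ 2 = sin (π * t) ^ 2 / (π * t) ^ 2 := by
  unfold GG
  rw [integral_EE _ _ _ ht, zero_mul, one_mul]
  have h0 : EE 0 = 1 := by simpa using EE_int 0
  have h1 : EE t = Complex.exp (Complex.I * ((-2 * π * t : ℝ) : ℂ)) := by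
    unfold EE; rw [mul_comm]
  rw [h0, norm_div, h1, Complex.norm_exp_I_mul_ofReal_sub_one, norm_mul _ Complex.I, Complex.norm_I,
    Complex.norm_real, Real.norm_eq_abs, Real.norm_eq_abs, div_pow, mul_one, sq_abs, sq_abs]
  have : -2 * π * t / 2 = -(π * t) := by ring
  rw [this, Real.sin_neg]
  have := Real.pi_ne_zero
  field_simp

lemma num_half (t : ℝ) (ht : 0 < t) (ht2 : t ≤ 1 / 2) :
    0.71 ≤ sin (π * t) ^ 2 / (π * t) ^ 2 + sin (π * t) ^ 2 / (π * (1 - t)) ^ 2 := by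
  have hp := Real.pi_pos
  have hp2 : π ^ 2 < 9.87 := by
    have := Real.pi_lt_d4
    nlinarith
  have h1t : 0 < 1 - t := by linarith
  rcases le_total t 0.4 with h | h
  · have hs : π * t * (1 - 1.645 * t ^ 2) ≤ sin (π * t) := by
      have := Real.sin_ge_sub_cube (x := π * t) (by positivity)
      have h3 : (π * t) * (t ^ 2 * π ^ 2) ≤ (π * t) * (t ^ 2 * 9.87) := by gcongr
      nlinarith
    have hpos : 0 < 1 - 1.645 * t ^ 2 := by nlinarith
    have hsq : (π * t) ^ 2 * (1 - 1.645 * t ^ 2) ^ 2 ≤ sin (π * t) ^ 2 := by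
      rw [← mul_pow]
      gcongr
    have key : 0.71 ≤ (1 - 1.645 * t ^ 2) ^ 2 * (1 + (t / (1 - t)) ^ 2) := by
      have seg : ∀ a b : ℝ, 0 ≤ a → a ≤ t → t ≤ b → b ≤ 0.4 →
          0.71 ≤ (1 - 1.645 * b ^ 2) ^ 2 * (1 + (a / (1 - a)) ^ 2) →
          0.71 ≤ (1 - 1.645 * t ^ 2) ^ 2 * (1 + (t / (1 - t)) ^ 2) := by
        intro a b ha hat htb hb h
        refine h.trans ?_
        have : 0 ≤ 1 - 1.645 * b ^ 2 := by nlinarith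
        have : 0 < 1 - a := by linarith
        gcongr
      rcases le_total t 0.3 with h3 | h3
      · exact seg 0 0.3 (by norm_num) ht.le h3 (by norm_num) (by norm_num)
      rcases le_total t 0.35 with h4 | h4
      · exact seg 0.3 0.35 (by norm_num) h3 h4 (by norm_num) (by norm_num)
      rcases le_total t 0.38 with h5 | h5
      · exact seg 0.35 0.38 (by norm_num) h4 h5 (by norm_num) (by norm_num)
      · exact seg 0.38 0.4 (by norm_num) h5 h (by norm_num) (by norm_num)
    have e : sin (π * t) ^ 2 / (π * t) ^ 2 + sin (π * t) ^ 2 / (π * (1 - t)) ^ 2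
        = sin (π * t) ^ 2 / (π * t) ^ 2 * (1 + (t / (1 - t)) ^ 2) := by
      field_simp
    rw [e]
    refine key.trans ?_
    gcongr
    rw [le_div_iff₀ (by positivity)]
    linarith
  · have hc : 0.95 ≤ sin (π * t) := by
      have := Real.one_sub_sq_div_two_le_cos (x := π / 2 - π * t)
      rw [Real.cos_pi_div_two_sub] at this
      have e : (π / 2 - π * t) ^ 2 = π ^ 2 * (1 / 2 - t) ^ 2 := by ring
      have h3 : (1 / 2 - t) ^ 2 ≤ 0.01 := by nlinarith
      have h4 : π ^ 2 * (1 / 2 - t) ^ 2 ≤ 9.87 * 0.01 := by gcongr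
      rw [e] at this
      linarith
    have hc2 : 0.9025 ≤ sin (π * t) ^ 2 := by nlinarith
    have e : sin (π * t) ^ 2 / (π * t) ^ 2 + sin (π * t) ^ 2 / (π * (1 - t)) ^ 2
        = sin (π * t) ^ 2 * (1 / t ^ 2 + 1 / (1 - t) ^ 2) / π ^ 2 := by
      field_simp
    have h8 : 8 ≤ 1 / t ^ 2 + 1 / (1 - t) ^ 2 := by
      have hu : 0 < t * (1 - t) := by positivity
      have hu4 : t * (1 - t) ≤ 1 / 4 := by nlinarith [sq_nonneg (t - 1 / 2)]
      have : 1 / t ^ 2 + 1 / (1 - t) ^ 2 = (1 - 2 * (t * (1 - t))) / (t * (1 - t)) ^ 2 := by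
        field_simp
        ring
      rw [this, le_div_iff₀ (by positivity)]
      nlinarith
    rw [e, le_div_iff₀ (by positivity)]
    nlinarith

lemma num_full (t : ℝ) (ht : 0 < t) (ht2 : t < 1) :
    0.71 ≤ ‖GG (t - 1)‖ ^ 2 + ‖GG t‖ ^ 2 := by
  rw [GG_normsq _ (by linarith), GG_normsq _ ht.ne']
  have e : sin (π * (t - 1)) ^ 2 = sin (π * t) ^ 2 := by
    rw [show π * (t - 1) = π * t - π by ring, Real.sin_sub_pi, neg_sq]
  have e' : sin (π * (1 - t)) ^ 2 = sin (π * t) ^ 2 := by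
    rw [show π * (1 - t) = π - π * t by ring, Real.sin_pi_sub]
  have e2 : (π * (t - 1)) ^ 2 = (π * (1 - t)) ^ 2 := by ring
  rw [e, e2]
  rcases le_total t (1 / 2) with h | h
  · linarith [num_half t ht h]
  · have := num_half (1 - t) (by linarith) (by linarith)
    rw [e', sub_sub_cancel] at this
    linarith

/-- One-dimensional lower bound for periodic weights. -/
lemma one_dim (p : ℝ → ℝ) (hp : Continuous p) (h0 : ∀ t, 0 ≤ p t) (hper : ∀ t, p (t - 1) = p t) :
    0.71 * ∫ t in (0:ℝ)..1, p t ≤ ∫ t in (-1:ℝ)..1, p t * ‖GG t‖ ^ 2 := by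
  have hc : Continuous fun t => p t * ‖GG t‖ ^ 2 := hp.mul (GG_cont.norm.pow 2)
  have hc' : Continuous fun t => p (t - 1) * ‖GG (t - 1)‖ ^ 2 := hc.comp (continuous_sub_right 1)
  have e : ∫ t in (-1:ℝ)..0, p t * ‖GG t‖ ^ 2
      = ∫ t in (0:ℝ)..1, p (t - 1) * ‖GG (t - 1)‖ ^ 2 := by
    rw [intervalIntegral.integral_comp_sub_right (fun t => p t * ‖GG t‖ ^ 2) 1]
    norm_num
  rw [← intervalIntegral.integral_add_adjacent_intervals (b := 0)
    (hc.intervalIntegrable _ _) (hc.intervalIntegrable _ _), e,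
    ← intervalIntegral.integral_add (hc'.intervalIntegrable _ _) (hc.intervalIntegrable _ _),
    ← intervalIntegral.integral_const_mul]
  apply intervalIntegral.integral_mono_on_of_le_Ioo (by norm_num)
    ((continuous_const.mul hp).intervalIntegrable _ _)
    ((hc'.add hc).intervalIntegrable _ _)
  intro t ht
  have := num_full t ht.1 ht.2
  change 0.71 * p t ≤ p (t - 1) * ‖GG (t - 1)‖ ^ 2 + p t * ‖GG t‖ ^ 2
  rw [hper]
  nlinarith [h0 t]

/-- One-dimensional Parseval for trigonometric polynomials. -/
lemma parseval {N : ℕ} (c : Fin N → ℂ) :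
    ∫ t in (0:ℝ)..1, ‖∑ j, c j * EE (j * t)‖ ^ 2 = ∑ j, ‖c j‖ ^ 2 := by
  have key : ∀ t : ℝ, ((‖∑ j, c j * EE (j * t)‖ ^ 2 : ℝ) : ℂ)
      = ∑ j, ∑ k, (c j * (starRingEnd ℂ) (c k)) * EE (t * ((j : ℝ) - (k : ℝ))) := by
    intro t
    push_cast
    rw [← Complex.mul_conj', map_sum, Finset.sum_mul_sum]
    refine Finset.sum_congr rfl fun j _ => Finset.sum_congr rfl fun k _ => ?_
    rw [map_mul, EE_conj, show t * ((j : ℝ) - (k : ℝ)) = j * t + -(k * t) by ring, EE_add]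
    ring
  have hcont : ∀ r : ℝ, Continuous fun t : ℝ => EE (t * r) := fun r => EE_cont.comp (by fun_prop)
  have : ((∫ t in (0:ℝ)..1, ‖∑ j, c j * EE (j * t)‖ ^ 2 : ℝ) : ℂ) = ((∑ j, ‖c j‖ ^ 2 : ℝ) : ℂ) := by
    rw [← intervalIntegral.integral_ofReal]
    simp_rw [key]
    rw [intervalIntegral.integral_finsetSum]
    swap
    · intro j _
      exact Continuous.intervalIntegrable
        (continuous_finsetSum _ fun k _ => (continuous_const.mul (hcont _))) _ _
    push_cast
    refine Finset.sum_congr rfl fun j _ => ?_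
    rw [intervalIntegral.integral_finsetSum]
    swap
    · intro k _
      exact Continuous.intervalIntegrable (continuous_const.mul (hcont _)) _ _
    rw [Finset.sum_eq_single j]
    · have h0 : EE 0 = 1 := by simpa using EE_int 0
      simp [h0, Complex.mul_conj']
    · intro k _ hk
      have hne : ((j : ℝ) - (k : ℝ)) ≠ 0 := by
        intro h
        apply hk
        ext
        have h' : (j : ℝ) = (k : ℝ) := by linarith
        exact_mod_cast h'.symm
      rw [intervalIntegral.integral_const_mul, integral_EE _ _ _ hne]
      have h0 : EE 0 = 1 := by simpa using EE_int 0
      have h1 : EE ((j : ℝ) - (k : ℝ)) = 1 := by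
        have := EE_int ((j : ℤ) - (k : ℤ))
        push_cast at this
        exact this
      simp [h0, h1]
    · simp
  exact_mod_cast this

/-- Indicator of `[a, a+1)`. -/
noncomputable def UU (a x : ℝ) : ℂ := if a ≤ x ∧ x < a + 1 then 1 else 0

lemma integral_UU (a t : ℝ) : ∫ x, UU a x * EE (x * t) = EE (a * t) * GG t := by
  have h1 : (fun x => UU a x * EE (x * t)) = (Set.Ico a (a + 1)).indicator fun x => EE (x * t) := by
    funext x
    unfold UU
    by_cases h : a ≤ x ∧ x < a + 1
    · rw [if_pos h, Set.indicator_of_mem (by exact h), one_mul]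
    · rw [if_neg h, Set.indicator_of_notMem (by exact h), zero_mul]
  rw [h1, integral_indicator measurableSet_Ico, integral_Ico_eq_integral_Ioc,
    ← intervalIntegral.integral_of_le (by linarith)]
  unfold GG
  rw [← intervalIntegral.integral_const_mul]
  have h2 : ∀ x, EE (a * t) * EE (x * t) = EE ((x + a) * t) := by
    intro x
    rw [← EE_add]
    congr 1
    ring
  simp_rw [h2]
  rw [intervalIntegral.integral_comp_add_right (fun x => EE (x * t)) a, zero_add, add_comm a 1]

lemma integrable_UU (a t : ℝ) : Integrable fun x => UU a x * EE (x * t) := by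
  have h1 : (fun x => UU a x * EE (x * t)) = (Set.Ico a (a + 1)).indicator fun x => EE (x * t) := by
    funext x
    unfold UU
    by_cases h : a ≤ x ∧ x < a + 1
    · rw [if_pos h, Set.indicator_of_mem (by exact h), one_mul]
    · rw [if_neg h, Set.indicator_of_notMem (by exact h), zero_mul]
  rw [h1, integrable_indicator_iff measurableSet_Ico]
  have hc : Continuous fun x => EE (x * t) := EE_cont.comp (by fun_prop)
  exact (hc.integrableOn_Icc (a := a) (b := a + 1)).mono_set Set.Ico_subset_Icc_self

/-- The identification of the Euclidean plane with `ℝ × ℝ`. -/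
noncomputable def ee2 : EuclideanSpace ℝ (Fin 2) ≃ᵐ ℝ × ℝ :=
  (MeasurableEquiv.toLp 2 (Fin 2 → ℝ)).symm.trans MeasurableEquiv.finTwoArrow

lemma ee2_apply (x : EuclideanSpace ℝ (Fin 2)) : ee2 x = (x 0, x 1) := rfl

lemma ee2_mp : MeasurePreserving ee2 volume volume :=
  (EuclideanSpace.volume_preserving_symm_measurableEquiv_toLp (Fin 2)).trans
    (volume_preserving_finTwoArrow ℝ)

/-- The trigonometric polynomial. -/
noncomputable def PP {N : ℕ} (z : Fin N → Fin N → ℂ) (s t : ℝ) : ℂ :=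
  ∑ j, (∑ i, z i j * EE (i * s)) * EE (j * t)

lemma PP_cont {N : ℕ} (z : Fin N → Fin N → ℂ) : Continuous fun p : ℝ × ℝ => PP z p.1 p.2 := by
  unfold PP
  have := EE_cont
  fun_prop

lemma f_eq {N : ℕ} (z : Fin N → Fin N → ℂ) (f : EuclideanSpace ℝ (Fin 2) → ℂ)
    (hf0 : ∀ x : EuclideanSpace ℝ (Fin 2),
      ¬ (0 ≤ x 0 ∧ x 0 ≤ N ∧ 0 ≤ x 1 ∧ x 1 ≤ N) → f x = 0)
    (hf : ∀ (i j : Fin N) (x : EuclideanSpace ℝ (Fin 2)),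
      (i : ℝ) ≤ x 0 → x 0 < i + 1 → (j : ℝ) ≤ x 1 → x 1 < j + 1 → f x = z i j)
    (x : EuclideanSpace ℝ (Fin 2)) (h0 : x 0 ≠ N) (h1 : x 1 ≠ N) :
    f x = ∑ j : Fin N, ∑ i : Fin N, z i j * (UU i (x 0) * UU j (x 1)) := by
  by_cases h : ∃ i j : Fin N, ((i : ℝ) ≤ x 0 ∧ x 0 < i + 1) ∧ ((j : ℝ) ≤ x 1 ∧ x 1 < j + 1)
  · obtain ⟨i, j, hi, hj⟩ := h
    rw [hf i j x hi.1 hi.2 hj.1 hj.2]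
    have uniq : ∀ (y : ℝ) (k l : Fin N), ((k : ℝ) ≤ y ∧ y < k + 1) → ((l : ℝ) ≤ y ∧ y < l + 1) →
        k = l := by
      intro y k l hk hl
      have a1 : (k : ℝ) < l + 1 := by linarith
      have a2 : (l : ℝ) < k + 1 := by linarith
      have b1 : (k : ℕ) < l + 1 := by exact_mod_cast a1
      have b2 : (l : ℕ) < k + 1 := by exact_mod_cast a2
      ext
      omega
    rw [Finset.sum_eq_single j, Finset.sum_eq_single i]
    · simp [UU, hi, hj]
    · intro k _ hk
      have : UU k (x 0) = 0 := if_neg fun h => hk (uniq _ _ _ h hi)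
      simp [this]
    · simp
    · intro k _ hk
      have : UU k (x 1) = 0 := if_neg fun h => hk (uniq _ _ _ h hj)
      simp [this]
    · simp
  · have ex : ∀ y : ℝ, 0 ≤ y → y < N → ∃ k : Fin N, (k : ℝ) ≤ y ∧ y < k + 1 := by
      intro y hy hyN
      refine ⟨⟨⌊y⌋₊, (Nat.floor_lt hy).2 hyN⟩, Nat.floor_le hy, Nat.lt_floor_add_one y⟩
    rw [hf0]
    · symm
      refine Finset.sum_eq_zero fun j _ => Finset.sum_eq_zero fun i _ => ?_
      by_cases hi : (i : ℝ) ≤ x 0 ∧ x 0 < i + 1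
      · have : UU j (x 1) = 0 := if_neg fun hj => h ⟨i, j, hi, hj⟩
        simp [this]
      · have : UU i (x 0) = 0 := if_neg hi
        simp [this]
    · rintro ⟨a, b, c, d⟩
      obtain ⟨i, hi⟩ := ex _ a (lt_of_le_of_ne b h0)
      obtain ⟨j, hj⟩ := ex _ c (lt_of_le_of_ne d h1)
      exact h ⟨i, j, hi, hj⟩

lemma fourier_formula {N : ℕ} (z : Fin N → Fin N → ℂ) (f : EuclideanSpace ℝ (Fin 2) → ℂ)
    (hf0 : ∀ x : EuclideanSpace ℝ (Fin 2),
      ¬ (0 ≤ x 0 ∧ x 0 ≤ N ∧ 0 ≤ x 1 ∧ x 1 ≤ N) → f x = 0)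
    (hf : ∀ (i j : Fin N) (x : EuclideanSpace ℝ (Fin 2)),
      (i : ℝ) ≤ x 0 → x 0 < i + 1 → (j : ℝ) ≤ x 1 → x 1 < j + 1 → f x = z i j)
    (ξ : EuclideanSpace ℝ (Fin 2)) :
    𝓕 f ξ = PP z (ξ 0) (ξ 1) * (GG (ξ 0) * GG (ξ 1)) := by
  rw [Real.fourier_eq']
  let h : ℝ × ℝ → ℂ := fun p => ∑ j : Fin N, ∑ i : Fin N,
    z i j * ((UU i p.1 * EE (p.1 * ξ 0)) * (UU j p.2 * EE (p.2 * ξ 1)))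
  have hae : ∀ᵐ p : ℝ × ℝ, p.1 ≠ N ∧ p.2 ≠ N :=
    (Measure.quasiMeasurePreserving_fst.ae (Measure.ae_ne volume (N : ℝ))).and
      (Measure.quasiMeasurePreserving_snd.ae (Measure.ae_ne volume (N : ℝ)))
  have hae' := ee2_mp.quasiMeasurePreserving.ae hae
  have e1 : ∫ v : EuclideanSpace ℝ (Fin 2),
      Complex.exp (((-2 * π * inner ℝ v ξ : ℝ) : ℂ) * Complex.I) • f v = ∫ v, h (ee2 v) := by
    apply integral_congr_ae
    filter_upwards [hae'] with v hv
    rw [ee2_apply] at hv ⊢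
    have hin : inner ℝ v ξ = v 0 * ξ 0 + v 1 * ξ 1 := by
      rw [PiLp.inner_apply, Fin.sum_univ_two]
      simp [mul_comm]
    change EE (inner ℝ v ξ) * f v = _
    rw [hin, EE_add, f_eq z f hf0 hf v hv.1 hv.2, Finset.mul_sum]
    refine Finset.sum_congr rfl fun j _ => ?_
    rw [Finset.mul_sum]
    refine Finset.sum_congr rfl fun i _ => ?_
    ring
  rw [e1, ee2_mp.integral_comp ee2.measurableEmbedding]
  have hint : ∀ i j : Fin N, Integrable (fun p : ℝ × ℝ =>
      z i j * ((UU i p.1 * EE (p.1 * ξ 0)) * (UU j p.2 * EE (p.2 * ξ 1)))) := fun i j =>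
    ((integrable_UU i (ξ 0)).mul_prod (integrable_UU j (ξ 1))).const_mul _
  rw [integral_finsetSum _ fun j _ => integrable_finsetSum _ fun i _ => hint i j]
  unfold PP
  rw [Finset.sum_mul]
  refine Finset.sum_congr rfl fun j _ => ?_
  rw [integral_finsetSum _ fun i _ => hint i j, Finset.sum_mul, Finset.sum_mul]
  refine Finset.sum_congr rfl fun i _ => ?_
  have := integral_prod_mul (μ := (volume : Measure ℝ)) (ν := (volume : Measure ℝ))
    (fun x => UU i x * EE (x * ξ 0)) (fun y => UU j y * EE (y * ξ 1))
  rw [integral_const_mul]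
  refine (congrArg (z i j * ·) this).trans ?_
  simp only
  rw [integral_UU, integral_UU]
  ring

lemma EE_nat_per (n : ℕ) (s : ℝ) : EE (n * (s - 1)) = EE (n * s) := by
  rw [show (n : ℝ) * (s - 1) = n * s + ((-n : ℤ) : ℝ) by push_cast; ring, EE_add, EE_int, mul_one]

lemma two_dim {N : ℕ} (z : Fin N → Fin N → ℂ) :
    0.71 * (0.71 * ∑ i, ∑ j, ‖z i j‖ ^ 2) ≤
      ∫ s in (-1:ℝ)..1, ∫ t in (-1:ℝ)..1, ‖PP z s t * (GG s * GG t)‖ ^ 2 := by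
  have hE := EE_cont
  have hG := GG_cont
  let q : ℝ → ℝ := fun s => ∑ j : Fin N, ‖∑ i : Fin N, z i j * EE (i * s)‖ ^ 2
  have hq : Continuous q := by
    unfold q
    fun_prop
  have hqi : ∫ s in (0:ℝ)..1, q s = ∑ i, ∑ j, ‖z i j‖ ^ 2 := by
    unfold q
    rw [intervalIntegral.integral_finsetSum, Finset.sum_comm]
    · exact Finset.sum_congr rfl fun j _ => parseval _
    · intro j _
      apply Continuous.intervalIntegrable
      fun_prop
  have inner_bd : ∀ s, 0.71 * q s ≤ ∫ t in (-1:ℝ)..1, ‖PP z s t‖ ^ 2 * ‖GG t‖ ^ 2 := by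
    intro s
    have h1 := one_dim (fun t => ‖PP z s t‖ ^ 2)
      (((PP_cont z).comp (Continuous.prodMk_right s)).norm.pow 2) (fun t => by positivity)
      (fun t => by simp only [PP, EE_nat_per])
    have h2 : ∫ t in (0:ℝ)..1, ‖PP z s t‖ ^ 2 = q s := parseval _
    rwa [h2] at h1
  have h1 := one_dim q hq (fun t => Finset.sum_nonneg fun j _ => by positivity)
    (fun t => by simp only [q, EE_nat_per])
  rw [hqi] at h1
  have hPc := PP_cont z
  have hcont : Continuous fun s => ∫ t in (-1:ℝ)..1, ‖PP z s t * (GG s * GG t)‖ ^ 2 := by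
    apply intervalIntegral.continuous_parametric_intervalIntegral_of_continuous'
    change Continuous fun p : ℝ × ℝ => ‖PP z p.1 p.2 * (GG p.1 * GG p.2)‖ ^ 2
    fun_prop
  calc 0.71 * (0.71 * ∑ i, ∑ j, ‖z i j‖ ^ 2)
      ≤ 0.71 * ∫ s in (-1:ℝ)..1, q s * ‖GG s‖ ^ 2 := by gcongr
    _ = ∫ s in (-1:ℝ)..1, 0.71 * (q s * ‖GG s‖ ^ 2) := by
        rw [intervalIntegral.integral_const_mul]
    _ ≤ _ := by
        apply intervalIntegral.integral_mono_on (by norm_num)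
        · apply Continuous.intervalIntegrable
          fun_prop
        · exact hcont.intervalIntegrable _ _
        intro s _
        have e : ∀ t, ‖PP z s t * (GG s * GG t)‖ ^ 2
            = ‖GG s‖ ^ 2 * (‖PP z s t‖ ^ 2 * ‖GG t‖ ^ 2) := by
          intro t
          rw [norm_mul, norm_mul]
          ring
        simp_rw [e]
        rw [intervalIntegral.integral_const_mul]
        nlinarith [inner_bd s, sq_nonneg ‖GG s‖]

/-- For all sufficiently large `A`, more than half of the L² mass of the Fourier
transform of a (nonzero) checkerboard step function lies in the ball `{|ξ| < A}`. -/
theorem fourier_mass_in_ball :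
    ∃ A₀ : ℝ, 0 < A₀ ∧
      ∀ (N : ℕ), 0 < N →
        ∀ (z : Fin N → Fin N → ℂ) (f : EuclideanSpace ℝ (Fin 2) → ℂ),
          (∃ i j : Fin N, z i j ≠ 0) →
          (∀ x : EuclideanSpace ℝ (Fin 2),
            ¬ (0 ≤ x 0 ∧ x 0 ≤ N ∧ 0 ≤ x 1 ∧ x 1 ≤ N) → f x = 0) →
          (∀ (i j : Fin N) (x : EuclideanSpace ℝ (Fin 2)),
            (i : ℝ) ≤ x 0 → x 0 < i + 1 → (j : ℝ) ≤ x 1 → x 1 < j + 1 → f x = z i j) →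
          ∀ A : ℝ, A₀ ≤ A →
            (1 / 2) * ∑ i, ∑ j, ‖z i j‖ ^ 2
              < ∫ ξ in {ξ : EuclideanSpace ℝ (Fin 2) | ‖ξ‖ < A}, ‖𝓕 f ξ‖ ^ 2 := by
  refine ⟨2, by norm_num, ?_⟩
  intro N _ z f hz hf0 hf A hA
  simp_rw [fourier_formula z f hf0 hf]
  have hE := EE_cont
  have hG := GG_cont
  have hPc := PP_cont z
  have hpos : 0 < ∑ i, ∑ j, ‖z i j‖ ^ 2 := by
    obtain ⟨i, j, hij⟩ := hz
    refine Finset.sum_pos' (fun i _ => Finset.sum_nonneg fun j _ => by positivity)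
      ⟨i, Finset.mem_univ _, Finset.sum_pos' (fun j _ => by positivity)
      ⟨j, Finset.mem_univ _, by positivity⟩⟩
  let H : ℝ × ℝ → ℝ := fun p => ‖PP z p.1 p.2 * (GG p.1 * GG p.2)‖ ^ 2
  have hH : Continuous H := by
    unfold H
    fun_prop
  let S : Set (ℝ × ℝ) := Set.Ioc (-1) 1 ×ˢ Set.Ioc (-1) 1
  have hSint : IntegrableOn H S :=
    (hH.continuousOn.integrableOn_compact (isCompact_Icc.prod isCompact_Icc)).mono_set
      (Set.prod_mono (Set.Ioc_subset_Icc_self (a := (-1:ℝ)) (b := 1))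
        (Set.Ioc_subset_Icc_self (a := (-1:ℝ)) (b := 1)))
  have e1 : ∫ p in S, H p
      = ∫ s in (-1:ℝ)..1, ∫ t in (-1:ℝ)..1, ‖PP z s t * (GG s * GG t)‖ ^ 2 := by
    have := setIntegral_prod (μ := (volume : Measure ℝ)) (ν := (volume : Measure ℝ)) H hSint
    rw [intervalIntegral.integral_of_le (by norm_num)]
    simp_rw [intervalIntegral.integral_of_le (show (-1:ℝ) ≤ 1 by norm_num)]
    exact this
  have e2 : ∫ ξ in ee2 ⁻¹' S, H (ee2 ξ) = ∫ p in S, H p :=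
    ee2_mp.setIntegral_preimage_emb ee2.measurableEmbedding H S
  have hHe : Continuous fun ξ : EuclideanSpace ℝ (Fin 2) => H (ee2 ξ) := by
    refine hH.comp ?_
    change Continuous fun x : EuclideanSpace ℝ (Fin 2) => (x 0, x 1)
    fun_prop
  have hsub : ee2 ⁻¹' S ⊆ {ξ : EuclideanSpace ℝ (Fin 2) | ‖ξ‖ < A} := by
    intro ξ hξ
    obtain ⟨⟨a, b⟩, ⟨c, d⟩⟩ := hξ
    change -1 < ξ 0 at a
    change ξ 0 ≤ 1 at b
    change -1 < ξ 1 at c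
    change ξ 1 ≤ 1 at d
    change ‖ξ‖ < A
    have : ‖ξ‖ ^ 2 = ξ 0 ^ 2 + ξ 1 ^ 2 := by
      rw [EuclideanSpace.norm_sq_eq, Fin.sum_univ_two]
      simp
    nlinarith [norm_nonneg ξ]
  have hmono : ∫ ξ in ee2 ⁻¹' S, H (ee2 ξ)
      ≤ ∫ ξ in {ξ : EuclideanSpace ℝ (Fin 2) | ‖ξ‖ < A}, H (ee2 ξ) := by
    apply setIntegral_mono_set
    · refine (hHe.continuousOn.integrableOn_compact (isCompact_closedBall 0 A)).mono_set ?_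
      intro ξ hξ
      rw [mem_closedBall_zero_iff]
      exact le_of_lt hξ
    · exact Filter.Eventually.of_forall fun ξ => sq_nonneg _
    · exact hsub.eventuallyLE
  have := two_dim z
  rw [e2, e1] at hmono
  refine lt_of_lt_of_le ?_ (this.trans hmono)
  nlinarith
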